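/- Evolving-set upper bound on mixing (Theorem 3.2): fix ε ∈ (0,1) and t > 0. If (π_t^min · π_0^min)^{−1/2} · Π_{s=1}^{t} [ 1 − (1/2)·( (1/2)·(g_s/(1 − g_s/2))·Φ_s^* )² ] ≤ 2ε, then d(0,t) ≤ ε. -/

import Mathlib

open Filter

/-- The product `P^{s,t} = P_{s+1} ⋯ P_t` (identity when `s ≥ t`). -/
noncomputable def mprod (n : ℕ) (P : ℤ → Matrix (Fin n) (Fin n) ℝ) (s t : ℤ) :
    Matrix (Fin n) (Fin n) ℝ :=
  ((List.range (t - s).toNat).map (fun i => P (s + 1 + i))).prod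

/-- `π` is the family of target distributions for the sequence `P`. -/
def IsTarget (n : ℕ) (P : ℤ → Matrix (Fin n) (Fin n) ℝ) (π : ℤ → Fin n → ℝ) : Prop :=
  ∀ t : ℤ, (∀ y, 0 ≤ π t y) ∧ (∑ y, π t y = 1) ∧
    ∀ x y, Tendsto (fun s : ℤ => mprod n P s t x y) atBot (nhds (π t y))

/-- `d(0,t) = max_x (1/2) ∑_z |P^{0,t}(x,z) − π_t(z)|`. -/
noncomputable def dTV (n : ℕ) (P : ℤ → Matrix (Fin n) (Fin n) ℝ)
    (π : ℤ → Fin n → ℝ) (s t : ℤ) : ℝ :=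
  ⨆ x : Fin n, (1 / 2) * ∑ z, |mprod n P s t x z - π t z|

/-- The stationary flow `Q_s(A,B) = ∑_{x∈A} ∑_{y∈B} π_{s-1}(x) P_s(x,y)`. -/
noncomputable def flowQ (n : ℕ) (P : ℤ → Matrix (Fin n) (Fin n) ℝ)
    (π : ℤ → Fin n → ℝ) (s : ℤ) (A B : Finset (Fin n)) : ℝ :=
  ∑ x ∈ A, ∑ y ∈ B, π (s - 1) x * P s x y

/-- `Φ_s(S) = (Q_s(S,Sᶜ) + Q_s(Sᶜ,S)) / (2 π_{s-1}(S))`. -/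
noncomputable def bigPhi (n : ℕ) (P : ℤ → Matrix (Fin n) (Fin n) ℝ)
    (π : ℤ → Fin n → ℝ) (s : ℤ) (S : Finset (Fin n)) : ℝ :=
  (flowQ n P π s S Sᶜ + flowQ n P π s Sᶜ S) / (2 * ∑ x ∈ S, π (s - 1) x)

/-- The time-dependent bottleneck ratio
`Φ_s^* = inf{Φ_s(S) : S nonempty, π_{s-1}(S) ≤ 1/2}`. -/
noncomputable def bigPhiStar (n : ℕ) (P : ℤ → Matrix (Fin n) (Fin n) ℝ)
    (π : ℤ → Fin n → ℝ) (s : ℤ) : ℝ :=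
  sInf {r | ∃ S : Finset (Fin n), S.Nonempty ∧ (∑ x ∈ S, π (s - 1) x) ≤ 1 / 2 ∧
    r = bigPhi n P π s S}

/-- `g_s = min_z π_{s-1}(z)/π_s(z)`. -/
noncomputable def gq (n : ℕ) (π : ℤ → Fin n → ℝ) (s : ℤ) : ℝ :=
  ⨅ z : Fin n, π (s - 1) z / π s z

open Finset in
/-- Every `[0,1]`-valued function on a finite type is an average of indicators of finsets. -/
theorem exists_indicator_weights {ι : Type*} [Fintype ι] [DecidableEq ι] (q : ι → ℝ)
    (h0 : ∀ y, 0 ≤ q y) (h1 : ∀ y, q y ≤ 1) :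
    ∃ κ : Finset ι → ℝ, (∀ T, 0 ≤ κ T) ∧ ∑ T, κ T = 1 ∧
      ∀ y, ∑ T, κ T * (if y ∈ T then 1 else 0) = q y := by
  refine ⟨fun T => (∏ z ∈ T, q z) * ∏ z ∈ univ \ T, (1 - q z), fun T => ?_, ?_, fun y => ?_⟩
  · exact mul_nonneg (prod_nonneg fun z _ => h0 z)
      (prod_nonneg fun z _ => sub_nonneg.2 (h1 z))
  · have := prod_add q (fun z => 1 - q z) univ
    simpa using this.symm
  · have := prod_add q (fun z => if z = y then 0 else 1 - q z) univ
    have hl : ∏ z, (q z + if z = y then 0 else 1 - q z) = q y := by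
      rw [prod_eq_single y]
      · simp
      · intro z _ hz
        simp [hz]
      · simp
    rw [hl, powerset_univ] at this
    rw [this]
    refine sum_congr rfl fun T _ => ?_
    by_cases hy : y ∈ T
    · simp only [hy, if_true, mul_one]
      congr 1
      refine prod_congr rfl fun z hz => ?_
      have : z ≠ y := by
        rintro rfl
        simp [hy] at hz
      simp [this]
    · simp only [hy, if_false, mul_zero]
      rw [prod_eq_zero (i := y) (s := univ \ T) (by simp [hy]) (by simp), mul_zero]

/-- Averaging set masses against indicator weights. -/
theorem sum_weights_mul_mass {ι : Type*} [Fintype ι] [DecidableEq ι] (κ : Finset ι → ℝ)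
    (b : ι → ℝ) :
    ∑ T, κ T * ∑ y ∈ T, b y = ∑ y, b y * ∑ T, κ T * (if y ∈ T then 1 else 0) := by
  simp_rw [Finset.mul_sum]
  rw [Finset.sum_comm]
  refine Finset.sum_congr rfl fun T _ => ?_
  rw [← Finset.sum_subset (Finset.subset_univ T)]
  · exact Finset.sum_congr rfl fun y hy => by simp [hy, mul_comm]
  · intro y _ hy
    simp [hy]

/-- Jensen's inequality for the square root, for a finite family of weights. -/
theorem sum_mul_sqrt_le_sqrt_sum {ι : Type*} [Fintype ι] (κ m : ι → ℝ) (hκ : ∀ i, 0 ≤ κ i)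
    (hκ1 : ∑ i, κ i = 1) (hm : ∀ i, 0 ≤ m i) :
    ∑ i, κ i * √(m i) ≤ √(∑ i, κ i * m i) := by
  have h := Real.sum_sqrt_mul_sqrt_le Finset.univ (f := κ) (g := fun i => κ i * m i) hκ
    (fun i => mul_nonneg (hκ i) (hm i))
  rw [hκ1, Real.sqrt_one, one_mul] at h
  refine le_trans (le_of_eq (Finset.sum_congr rfl fun i _ => ?_)) h
  rw [Real.sqrt_mul (hκ i), ← mul_assoc, Real.mul_self_sqrt (hκ i)]

theorem half_sqrt_add_half_sqrt_le {A C p x : ℝ} (hA : 0 ≤ A) (hC : 0 ≤ C)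
    (hp : A + C = 2 * p) (hx : 0 ≤ x) (h : 2 * p * x ≤ A - C) :
    1 / 2 * √A + 1 / 2 * √C ≤ (1 - x ^ 2 / 8) * √p := by
  have hp0 : 0 ≤ p := by linarith
  rcases hp0.eq_or_lt with rfl | hp0
  · have hA0 : A = 0 := by linarith
    have hC0 : C = 0 := by linarith
    simp [hA0, hC0]
  have hx1 : x ≤ 1 := by
    by_contra! hx1
    nlinarith
  have hx2 : x ^ 2 ≤ 1 := by nlinarith
  rw [← abs_of_nonneg (show 0 ≤ 1 / 2 * √A + 1 / 2 * √C by positivity)]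
  have hr : 0 ≤ (1 - x ^ 2 / 8) * √p := mul_nonneg (by linarith) (Real.sqrt_nonneg _)
  refine abs_le_of_sq_le_sq ?_ hr
  have hAC : √A * √C ≤ p * (1 - x ^ 2 / 2) := by
    rw [← Real.sqrt_mul hA]
    apply Real.sqrt_le_iff.2
    refine ⟨mul_nonneg hp0.le (by linarith), ?_⟩
    have h1 : (2 * p * x) ^ 2 ≤ (A - C) ^ 2 :=
      pow_le_pow_left₀ (by positivity) h 2
    have h2 : 4 * (A * C) = (2 * p) ^ 2 - (A - C) ^ 2 := by rw [← hp]; ring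
    have h3 : 0 ≤ p ^ 2 * x ^ 4 := by positivity
    nlinarith
  have e1 : (1 / 2 * √A + 1 / 2 * √C) ^ 2 = 1 / 4 * (√A ^ 2 + √C ^ 2) + 1 / 2 * (√A * √C) := by
    ring
  rw [e1, mul_pow, Real.sq_sqrt hA, Real.sq_sqrt hC, Real.sq_sqrt hp0.le, hp]
  have : 0 ≤ p * x ^ 4 := by positivity
  nlinarith

/-- One step of the evolving-set process started from `S`, for a matrix `M` carrying the
distribution `a` to `b`. -/
theorem exists_evolving_step {ι : Type*} [Fintype ι] [DecidableEq ι] (M : Matrix ι ι ℝ)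
    (a b : ι → ℝ) (hM : ∀ x y, 0 ≤ M x y) (hM1 : ∀ x, ∑ y, M x y = 1)
    (hlazy : ∀ x, 1 / 2 ≤ M x x) (ha : ∀ x, 0 ≤ a x) (hb : ∀ x, 0 < b x)
    (hab : ∀ y, ∑ x, a x * M x y = b y) (g φ : ℝ) (hg0 : 0 ≤ g) (hg1 : g ≤ 1)
    (hg : ∀ z, g * b z ≤ a z) (hφ : 0 ≤ φ) (S : Finset ι)
    (hS : 2 * (∑ x ∈ S, a x) * φ ≤
      ∑ x ∈ S, ∑ y ∈ Sᶜ, a x * M x y + ∑ x ∈ Sᶜ, ∑ y ∈ S, a x * M x y) :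
    ∃ κ : Finset ι → ℝ, (∀ T, 0 ≤ κ T) ∧ ∑ T, κ T = 1 ∧
      (∀ y, b y * ∑ T, κ T * (if y ∈ T then 1 else 0) = ∑ x ∈ S, a x * M x y) ∧
      ∑ T, κ T * √(∑ y ∈ T, b y) ≤
        (1 - 1 / 2 * (1 / 2 * (g / (1 - g / 2)) * φ) ^ 2) * √(∑ x ∈ S, a x) := by
  set u : ι → ℝ := fun y => ∑ x ∈ S, a x * M x y with hu
  set v : ι → ℝ := fun y => ∑ x ∈ Sᶜ, a x * M x y with hv
  have huv : ∀ y, u y + v y = b y := fun y => by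
    rw [← hab y, ← Finset.sum_add_sum_compl S]
  have hterm : ∀ x y, 0 ≤ a x * M x y := fun x y => mul_nonneg (ha x) (hM x y)
  have hu0 : ∀ y, 0 ≤ u y := fun y => Finset.sum_nonneg fun x _ => hterm x y
  have hv0 : ∀ y, 0 ≤ v y := fun y => Finset.sum_nonneg fun x _ => hterm x y
  have hdiag : ∀ y, g / 2 * b y ≤ a y * M y y := fun y => by
    have := mul_le_mul_of_nonneg_left (hlazy y) (ha y)
    linarith [hg y]
  have huS : ∀ y ∈ S, g / 2 * b y ≤ u y := fun y hy =>
    (hdiag y).trans (Finset.single_le_sum (f := fun x => a x * M x y)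
      (fun x _ => hterm x y) hy)
  have hvS : ∀ y ∈ Sᶜ, g / 2 * b y ≤ v y := fun y hy =>
    (hdiag y).trans (Finset.single_le_sum (f := fun x => a x * M x y)
      (fun x _ => hterm x y) hy)
  set γ := g / (1 - g / 2) with hγ
  have hden : 0 < 1 - g / 2 := by linarith
  have hγ0 : 0 ≤ γ := div_nonneg hg0 hden.le
  have hγ2 : γ ≤ 2 := by
    rw [hγ, div_le_iff₀ hden]
    linarith
  have hcmp : ∀ r w : ℝ, 0 ≤ w → g / 2 * (r + w) ≤ r → γ * w ≤ 2 * min r w := by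
    intro r w hw h
    rcases min_cases r w with ⟨e, _⟩ | ⟨e, _⟩ <;> rw [e]
    · rw [hγ, div_mul_eq_mul_div, div_le_iff₀ hden]
      linarith
    · exact mul_le_mul_of_nonneg_right hγ2 hw
  obtain ⟨κ₁, h₁0, h₁1, h₁⟩ := exists_indicator_weights (fun y => min (2 * u y / b y) 1)
    (fun y => le_min (div_nonneg (by linarith [hu0 y]) (hb y).le) zero_le_one)
    (fun y => min_le_right _ _)
  obtain ⟨κ₂, h₂0, h₂1, h₂⟩ := exists_indicator_weights
    (fun y => max ((u y - v y) / b y) 0) (fun y => le_max_right _ _)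
    (fun y => max_le (by rw [div_le_one (hb y)]; linarith [huv y, hv0 y]) zero_le_one)
  have hb₁ : ∀ y, b y * min (2 * u y / b y) 1 = u y + min (u y) (v y) := fun y => by
    rw [mul_min_of_nonneg _ _ (hb y).le, mul_div_cancel₀ _ (hb y).ne', mul_one, ← huv y,
      two_mul, min_add_add_left]
  have hb₂ : ∀ y, b y * max ((u y - v y) / b y) 0 = u y - min (u y) (v y) := fun y => by
    rw [mul_max_of_nonneg _ _ (hb y).le, mul_div_cancel₀ _ (hb y).ne', mul_zero]
    rcases le_total (u y) (v y) with h | h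
    · rw [max_eq_right (by linarith), min_eq_left h, sub_self]
    · rw [max_eq_left (by linarith), min_eq_right h]
  have hmass : ∀ T : Finset ι, 0 ≤ ∑ y ∈ T, b y := fun T =>
    Finset.sum_nonneg fun y _ => (hb y).le
  have husum : ∑ y, u y = ∑ x ∈ S, a x := by
    rw [hu, Finset.sum_comm]
    exact Finset.sum_congr rfl fun x _ => by rw [← Finset.mul_sum, hM1, mul_one]
  have j₁ := sum_mul_sqrt_le_sqrt_sum κ₁ (fun T => ∑ y ∈ T, b y) h₁0 h₁1 hmass
  have j₂ := sum_mul_sqrt_le_sqrt_sum κ₂ (fun T => ∑ y ∈ T, b y) h₂0 h₂1 hmass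
  rw [sum_weights_mul_mass] at j₁ j₂
  simp_rw [h₁, hb₁] at j₁
  simp_rw [h₂, hb₂] at j₂
  refine ⟨fun T => 1 / 2 * κ₁ T + 1 / 2 * κ₂ T, fun T => ?_, ?_, fun y => ?_, ?_⟩
  · linarith [h₁0 T, h₂0 T]
  · rw [Finset.sum_add_distrib, ← Finset.mul_sum, ← Finset.mul_sum, h₁1, h₂1]
    norm_num
  · simp_rw [add_mul, mul_assoc]
    rw [Finset.sum_add_distrib, ← Finset.mul_sum, ← Finset.mul_sum, h₁, h₂]
    linarith [hb₁ y, hb₂ y]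
  · have hsplit : ∑ T, (1 / 2 * κ₁ T + 1 / 2 * κ₂ T) * √(∑ y ∈ T, b y) =
        1 / 2 * ∑ T, κ₁ T * √(∑ y ∈ T, b y) + 1 / 2 * ∑ T, κ₂ T * √(∑ y ∈ T, b y) := by
      simp_rw [add_mul, mul_assoc]
      rw [Finset.sum_add_distrib, ← Finset.mul_sum, ← Finset.mul_sum]
    have hflow : γ * (∑ x ∈ S, ∑ y ∈ Sᶜ, a x * M x y + ∑ x ∈ Sᶜ, ∑ y ∈ S, a x * M x y) ≤
        ∑ y, 2 * min (u y) (v y) := by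
      have e₁ : ∑ x ∈ S, ∑ y ∈ Sᶜ, a x * M x y = ∑ y ∈ Sᶜ, u y := Finset.sum_comm
      have e₂ : ∑ x ∈ Sᶜ, ∑ y ∈ S, a x * M x y = ∑ y ∈ S, v y := Finset.sum_comm
      rw [e₁, e₂, add_comm, mul_add, Finset.mul_sum, Finset.mul_sum,
        ← Finset.sum_add_sum_compl S fun y => 2 * min (u y) (v y)]
      refine add_le_add (Finset.sum_le_sum fun y hy => ?_) (Finset.sum_le_sum fun y hy => ?_)
      · exact hcmp (u y) (v y) (hv0 y) (by rw [huv]; exact huS y hy)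
      · rw [min_comm]
        exact hcmp (v y) (u y) (hu0 y) (by rw [add_comm, huv]; exact hvS y hy)
    have hfin := half_sqrt_add_half_sqrt_le (A := ∑ y, (u y + min (u y) (v y)))
      (C := ∑ y, (u y - min (u y) (v y))) (p := ∑ x ∈ S, a x) (x := γ * φ)
      (Finset.sum_nonneg fun y _ => add_nonneg (hu0 y) (le_min (hu0 y) (hv0 y)))
      (Finset.sum_nonneg fun y _ => sub_nonneg.2 (min_le_left _ _))
      (by rw [← Finset.sum_add_distrib, ← husum, Finset.mul_sum]
          exact Finset.sum_congr rfl fun y _ => by ring)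
      (mul_nonneg hγ0 hφ)
      (by
        rw [← Finset.sum_sub_distrib]
        calc 2 * (∑ x ∈ S, a x) * (γ * φ) = γ * (2 * (∑ x ∈ S, a x) * φ) := by ring
          _ ≤ _ := mul_le_mul_of_nonneg_left hS hγ0
          _ ≤ _ := hflow
          _ = _ := Finset.sum_congr rfl fun y _ => by ring)
    rw [hsplit, show 1 / 2 * (1 / 2 * γ * φ) ^ 2 = (γ * φ) ^ 2 / 8 by ring]
    linarith

theorem mprod_self (n : ℕ) (P : ℤ → Matrix (Fin n) (Fin n) ℝ) (s : ℤ) :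
    mprod n P s s = 1 := by
  simp [mprod]

theorem mprod_succ (n : ℕ) (P : ℤ → Matrix (Fin n) (Fin n) ℝ) {r s : ℤ} (h : r ≤ s) :
    mprod n P r (s + 1) = mprod n P r s * P (s + 1) := by
  obtain ⟨k, rfl⟩ := Int.le.dest h
  have h1 : (r + k + 1 - r).toNat = k + 1 := by omega
  have h2 : (r + (k : ℤ) - r).toNat = k := by omega
  simp only [mprod, h1, h2]
  rw [List.range_succ]
  simp [add_right_comm]

/-- The target distributions are transported by the transition matrices. -/
theorem IsTarget.sum_mul_eq {n : ℕ} {P : ℤ → Matrix (Fin n) (Fin n) ℝ} {π : ℤ → Fin n → ℝ}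
    (hπ : IsTarget n P π) (s : ℤ) (y : Fin n) :
    ∑ x, π s x * P (s + 1) x y = π (s + 1) y := by
  have h1 := (hπ (s + 1)).2.2 y y
  have h2 : Tendsto (fun r : ℤ => ∑ x, mprod n P r s y x * P (s + 1) x y) atBot
      (nhds (∑ x, π s x * P (s + 1) x y)) :=
    tendsto_finsetSum _ fun x _ => ((hπ s).2.2 y x).mul_const _
  refine tendsto_nhds_unique h2 (h1.congr' ?_)
  filter_upwards [eventually_le_atBot s] with r hr
  rw [mprod_succ n P hr, Matrix.mul_apply]

theorem bigPhi_nonneg {n : ℕ} {P : ℤ → Matrix (Fin n) (Fin n) ℝ} {π : ℤ → Fin n → ℝ} {s : ℤ}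
    (hP : ∀ x y, 0 ≤ P s x y) (hπ : ∀ x, 0 ≤ π (s - 1) x) (S : Finset (Fin n)) :
    0 ≤ bigPhi n P π s S := by
  have h : ∀ A B, 0 ≤ flowQ n P π s A B := fun A B =>
    Finset.sum_nonneg fun x _ => Finset.sum_nonneg fun y _ => mul_nonneg (hπ x) (hP x y)
  exact div_nonneg (add_nonneg (h _ _) (h _ _))
    (mul_nonneg zero_le_two (Finset.sum_nonneg fun x _ => hπ x))

theorem bigPhiStar_nonneg {n : ℕ} {P : ℤ → Matrix (Fin n) (Fin n) ℝ} {π : ℤ → Fin n → ℝ}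
    {s : ℤ} (hP : ∀ x y, 0 ≤ P s x y) (hπ : ∀ x, 0 ≤ π (s - 1) x) :
    0 ≤ bigPhiStar n P π s := by
  refine Real.sInf_nonneg ?_
  rintro r ⟨S, -, -, rfl⟩
  exact bigPhi_nonneg hP hπ S

theorem two_mul_mass_mul_bigPhiStar_le {n : ℕ} {P : ℤ → Matrix (Fin n) (Fin n) ℝ}
    {π : ℤ → Fin n → ℝ} {s : ℤ} (hP : ∀ x y, 0 ≤ P s x y) (hπ : ∀ x, 0 < π (s - 1) x)
    {S : Finset (Fin n)} (hS : ∑ x ∈ S, π (s - 1) x ≤ 1 / 2) :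
    2 * (∑ x ∈ S, π (s - 1) x) * bigPhiStar n P π s ≤
      flowQ n P π s S Sᶜ + flowQ n P π s Sᶜ S := by
  rcases S.eq_empty_or_nonempty with rfl | hne
  · simp [flowQ]
  have hpos : 0 < 2 * ∑ x ∈ S, π (s - 1) x :=
    mul_pos two_pos (Finset.sum_pos (fun x _ => hπ x) hne)
  have h : bigPhiStar n P π s ≤ bigPhi n P π s S := by
    refine csInf_le ⟨0, ?_⟩ ⟨S, hne, hS, rfl⟩
    rintro r ⟨T, -, -, rfl⟩
    exact bigPhi_nonneg hP (fun x => (hπ x).le) T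
  rw [bigPhi, le_div_iff₀ hpos] at h
  linarith

theorem gq_mul_le {n : ℕ} {π : ℤ → Fin n → ℝ} {s : ℤ} (hs : ∀ z, 0 < π s z) (z : Fin n) :
    gq n π s * π s z ≤ π (s - 1) z := by
  rw [← le_div_iff₀ (hs z)]
  exact ciInf_le (Set.finite_range _).bddBelow z

/-- The one-step contraction factor of the evolving-set bound. -/
noncomputable def contraction (n : ℕ) (P : ℤ → Matrix (Fin n) (Fin n) ℝ)
    (π : ℤ → Fin n → ℝ) (s : ℤ) : ℝ :=
  1 - (1 / 2) * ((1 / 2) * (gq n π s / (1 - gq n π s / 2)) * bigPhiStar n P π s) ^ 2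

section Step

variable {n : ℕ} {P : ℤ → Matrix (Fin n) (Fin n) ℝ} {π : ℤ → Fin n → ℝ} {s : ℤ}

theorem exists_step_of_mass_le_half
    (hP : ∀ s, (∀ x y, 0 ≤ P s x y) ∧ ∀ x, ∑ y, P s x y = 1)
    (hlazy : ∀ s x, (1 : ℝ) / 2 ≤ P s x x) (hπ : IsTarget n P π)
    (h0 : ∀ z, 0 < π s z) (h1 : ∀ z, 0 < π (s + 1) z)
    {S : Finset (Fin n)} (hS : ∑ x ∈ S, π s x ≤ 1 / 2) :
    ∃ κ : Finset (Fin n) → ℝ, (∀ T, 0 ≤ κ T) ∧ ∑ T, κ T = 1 ∧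
      (∀ y, π (s + 1) y * ∑ T, κ T * (if y ∈ T then 1 else 0) =
        ∑ x ∈ S, π s x * P (s + 1) x y) ∧
      ∑ T, κ T * √(∑ y ∈ T, π (s + 1) y) ≤
        contraction n P π (s + 1) * √(∑ x ∈ S, π s x) := by
  have es : s + 1 - 1 = s := by ring
  have hg : ∀ z, gq n π (s + 1) * π (s + 1) z ≤ π s z := fun z => by
    simpa only [es] using gq_mul_le h1 z
  refine exists_evolving_step (P (s + 1)) (π s) (π (s + 1)) (hP _).1 (hP _).2 (hlazy _)
    (fun x => (h0 x).le) h1 (hπ.sum_mul_eq s) _ _ ?_ ?_ hg ?_ S ?_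
  · exact Real.iInf_nonneg fun z => by rw [es]; exact div_nonneg (h0 z).le (h1 z).le
  · have := Finset.sum_le_sum fun z (_ : z ∈ Finset.univ) => hg z
    rwa [← Finset.mul_sum, (hπ s).2.1, (hπ (s + 1)).2.1, mul_one] at this
  · exact bigPhiStar_nonneg (hP _).1 fun x => by rw [es]; exact (h0 x).le
  · have := two_mul_mass_mul_bigPhiStar_le (P := P) (π := π) (s := s + 1) (S := S) (hP _).1
      (fun x => by rw [es]; exact h0 x) (by rw [es]; exact hS)
    simpa only [flowQ, es] using this

theorem contraction_nonneg
    (hP : ∀ s, (∀ x y, 0 ≤ P s x y) ∧ ∀ x, ∑ y, P s x y = 1)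
    (hlazy : ∀ s x, (1 : ℝ) / 2 ≤ P s x x) (hπ : IsTarget n P π)
    (h0 : ∀ z, 0 < π s z) (h1 : ∀ z, 0 < π (s + 1) z) :
    0 ≤ contraction n P π (s + 1) := by
  by_cases h : ∃ S : Finset (Fin n), S.Nonempty ∧ ∑ x ∈ S, π s x ≤ 1 / 2
  · obtain ⟨S, hne, hS⟩ := h
    obtain ⟨κ, hκ, -, -, hle⟩ := exists_step_of_mass_le_half hP hlazy hπ h0 h1 hS
    have hpos : 0 < √(∑ x ∈ S, π s x) :=
      Real.sqrt_pos.2 (Finset.sum_pos (fun x _ => h0 x) hne)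
    exact nonneg_of_mul_nonneg_left
      ((Finset.sum_nonneg fun T _ => mul_nonneg (hκ T) (Real.sqrt_nonneg _)).trans hle) hpos
  · have hempty : bigPhiStar n P π (s + 1) = 0 := by
      rw [bigPhiStar, show s + 1 - 1 = s by ring]
      convert Real.sInf_empty
      refine Set.eq_empty_of_forall_notMem ?_
      rintro r ⟨S, hne, hS, -⟩
      exact h ⟨S, hne, hS⟩
    simp [contraction, hempty]

theorem mass_compl (hπ : IsTarget n P π) (s : ℤ) (S : Finset (Fin n)) :
    ∑ x ∈ Sᶜ, π s x = 1 - ∑ x ∈ S, π s x := by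
  rw [← (hπ s).2.1, ← Finset.sum_add_sum_compl S, add_sub_cancel_left]

theorem exists_step
    (hP : ∀ s, (∀ x y, 0 ≤ P s x y) ∧ ∀ x, ∑ y, P s x y = 1)
    (hlazy : ∀ s x, (1 : ℝ) / 2 ≤ P s x x) (hπ : IsTarget n P π)
    (h0 : ∀ z, 0 < π s z) (h1 : ∀ z, 0 < π (s + 1) z) (S : Finset (Fin n)) :
    ∃ κ : Finset (Fin n) → ℝ, (∀ T, 0 ≤ κ T) ∧
      (∀ y, π (s + 1) y * ∑ T, κ T * (if y ∈ T then 1 else 0) =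
        ∑ x ∈ S, π s x * P (s + 1) x y) ∧
      ∑ T, κ T * √(min (∑ y ∈ T, π (s + 1) y) (1 - ∑ y ∈ T, π (s + 1) y)) ≤
        contraction n P π (s + 1) * √(min (∑ x ∈ S, π s x) (1 - ∑ x ∈ S, π s x)) := by
  rcases le_total (∑ x ∈ S, π s x) (1 / 2) with hS | hS
  · obtain ⟨κ, hκ, -, hrep, hle⟩ := exists_step_of_mass_le_half hP hlazy hπ h0 h1 hS
    refine ⟨κ, hκ, hrep, ?_⟩
    rw [min_eq_left (show ∑ x ∈ S, π s x ≤ 1 - ∑ x ∈ S, π s x by linarith)]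
    exact (Finset.sum_le_sum fun T _ => mul_le_mul_of_nonneg_left
      (Real.sqrt_le_sqrt (min_le_left _ _)) (hκ T)).trans hle
  · obtain ⟨κ, hκ, hκ1, hrep, hle⟩ := exists_step_of_mass_le_half hP hlazy hπ h0 h1 (S := Sᶜ)
      (by rw [mass_compl hπ]; linarith)
    have hcompl : ∀ f : Finset (Fin n) → ℝ, ∑ T, f Tᶜ = ∑ T, f T := fun f =>
      Equiv.sum_comp (Function.Involutive.toPerm compl compl_involutive) f
    refine ⟨fun T => κ Tᶜ, fun T => hκ _, fun y => ?_, ?_⟩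
    · have e : ∑ T : Finset (Fin n), κ Tᶜ * (if y ∈ T then (1 : ℝ) else 0) =
          1 - ∑ T, κ T * (if y ∈ T then 1 else 0) := by
        nth_rw 2 [← hκ1]
        rw [← Finset.sum_sub_distrib, ← hcompl fun T =>
          κ T - κ T * (if y ∈ T then (1 : ℝ) else 0)]
        refine Finset.sum_congr rfl fun T _ => ?_
        by_cases hy : y ∈ T <;> simp [hy]
      rw [e, mul_sub, hrep, mul_one, ← hπ.sum_mul_eq s y, ← Finset.sum_add_sum_compl S,
        add_sub_cancel_right]
    · rw [min_eq_right (show 1 - ∑ x ∈ S, π s x ≤ ∑ x ∈ S, π s x by linarith),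
        ← mass_compl hπ s S]
      refine le_trans ?_ hle
      rw [← hcompl]
      simp only [compl_compl]
      refine Finset.sum_le_sum fun T _ => mul_le_mul_of_nonneg_left (Real.sqrt_le_sqrt ?_) (hκ T)
      rw [mass_compl hπ, sub_sub_cancel]
      exact min_le_right _ _

end Step

/-- The law of the chain at time `k`, relative to `π k`, is a nonnegative combination of
indicators of sets whose total size is controlled by the contraction factors. -/
theorem exists_set_representation {n : ℕ} {P : ℤ → Matrix (Fin n) (Fin n) ℝ}
    {π : ℤ → Fin n → ℝ} (hP : ∀ s, (∀ x y, 0 ≤ P s x y) ∧ ∀ x, ∑ y, P s x y = 1)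
    (hlazy : ∀ s x, (1 : ℝ) / 2 ≤ P s x x) (hπ : IsTarget n P π) (x : Fin n) (k : ℕ)
    (hpos : ∀ s : ℤ, 0 ≤ s → s ≤ (k : ℤ) → ∀ z, 0 < π s z) :
    ∃ w : Finset (Fin n) → ℝ, (∀ S, 0 ≤ w S) ∧
      (∀ y, mprod n P 0 k x y = π k y * ∑ S, w S * (if y ∈ S then 1 else 0)) ∧
      ∑ S, w S * √(min (∑ y ∈ S, π k y) (1 - ∑ y ∈ S, π k y)) ≤
        (∏ s ∈ Finset.Icc 1 k, contraction n P π s) * (1 / √(π 0 x)) := by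
  induction k with
  | zero =>
    have hx : 0 < π 0 x := hpos 0 le_rfl (by simp) x
    refine ⟨fun S => if S = {x} then 1 / π 0 x else 0, fun S => ?_, fun y => ?_, ?_⟩
    · dsimp only
      split_ifs
      exacts [(one_div_pos.2 hx).le, le_rfl]
    · simp only [Nat.cast_zero, mprod_self, Matrix.one_apply, ite_mul, zero_mul,
        Finset.sum_ite_eq', Finset.mem_univ, if_true, Finset.mem_singleton]
      rcases eq_or_ne x y with rfl | hxy
      · simp [hx.ne']
      · simp [hxy, hxy.symm]
    · simp only [Nat.cast_zero, ite_mul, zero_mul, Finset.sum_ite_eq', Finset.mem_univ, if_true,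
        Finset.sum_singleton]
      have h := Real.sqrt_le_sqrt (min_le_left (π 0 x) (1 - π 0 x))
      calc 1 / π 0 x * √(min (π 0 x) (1 - π 0 x)) ≤ 1 / π 0 x * √(π 0 x) :=
            mul_le_mul_of_nonneg_left h (one_div_pos.2 hx).le
        _ = 1 / √(π 0 x) := by
            rw [one_div_mul_eq_div, Real.sqrt_div_self', one_div]
        _ = _ := by simp
  | succ k ih =>
    obtain ⟨w, hw, hrep, hle⟩ := ih fun s hs hk => hpos s hs (by push_cast; omega)
    have h0 := hpos k (by positivity) (by push_cast; omega)
    have h1 := hpos ((k : ℤ) + 1) (by positivity) (by push_cast; omega)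
    choose κ hκ hκrep hκle using exists_step hP hlazy hπ h0 h1
    have hswap : ∀ f : Finset (Fin n) → ℝ,
        ∑ T, (∑ S, w S * κ S T) * f T = ∑ S, w S * ∑ T, κ S T * f T := fun f => by
      simp_rw [Finset.sum_mul, Finset.mul_sum, mul_assoc]
      exact Finset.sum_comm
    refine ⟨fun T => ∑ S, w S * κ S T,
      fun T => Finset.sum_nonneg fun S _ => mul_nonneg (hw S) (hκ S T), fun y => ?_, ?_⟩
    · push_cast
      rw [mprod_succ n P (by positivity), Matrix.mul_apply, hswap, Finset.mul_sum]
      simp_rw [hrep, mul_left_comm (π ((k : ℤ) + 1) y), hκrep]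
      have e : ∀ z, π k z * (∑ S, w S * (if z ∈ S then (1 : ℝ) else 0)) * P (k + 1) z y =
          (π k z * P (k + 1) z y) * ∑ S, w S * (if z ∈ S then (1 : ℝ) else 0) :=
        fun z => by ring
      simp_rw [e]
      rw [← sum_weights_mul_mass]
    · push_cast
      rw [hswap, Finset.prod_Icc_succ_top (by omega)]
      have hc := contraction_nonneg hP hlazy hπ h0 h1
      push_cast
      calc _ ≤ ∑ S, w S * (contraction n P π (k + 1) *
              √(min (∑ x ∈ S, π k x) (1 - ∑ x ∈ S, π k x))) :=
            Finset.sum_le_sum fun S _ => mul_le_mul_of_nonneg_left (hκle S) (hw S)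
        _ = contraction n P π (k + 1) *
              ∑ S, w S * √(min (∑ x ∈ S, π k x) (1 - ∑ x ∈ S, π k x)) := by
            rw [Finset.mul_sum]
            exact Finset.sum_congr rfl fun S _ => by ring
        _ ≤ _ := mul_le_mul_of_nonneg_left hle hc
        _ = _ := by ring

theorem two_mul_mul_one_sub_le_sqrt_min {m : ℝ} (h0 : 0 ≤ m) (h1 : m ≤ 1) :
    2 * (m * (1 - m)) ≤ √(min m (1 - m)) := by
  have key : ∀ r : ℝ, 0 ≤ r → r ≤ 1 → 2 * (r * (1 - r)) ≤ √r := fun r hr0 hr1 => by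
    apply Real.le_sqrt_of_sq_le
    nlinarith [mul_nonneg hr0 (sq_nonneg (2 * r - 1)), mul_nonneg hr0 (sub_nonneg.2 hr1),
      mul_nonneg (mul_nonneg hr0 (sub_nonneg.2 hr1)) (sq_nonneg (2 * r - 1))]
  rcases min_cases m (1 - m) with ⟨e, _⟩ | ⟨e, _⟩ <;> rw [e]
  · exact key m h0 h1
  · have := key (1 - m) (by linarith) (by linarith)
    linarith

/-- A probability vector represented by indicators of sets is close in `ℓ¹` to the reference
distribution when the sets used are close to being trivial. -/
theorem sum_abs_sub_le_of_representation {ι : Type*} [Fintype ι] [DecidableEq ι]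
    (μ b : ι → ℝ) (hb : ∀ y, 0 ≤ b y) (hb1 : ∑ y, b y = 1) (hμ1 : ∑ y, μ y = 1)
    (w : Finset ι → ℝ) (hw : ∀ S, 0 ≤ w S)
    (hrep : ∀ y, μ y = b y * ∑ S, w S * (if y ∈ S then 1 else 0)) :
    ∑ y, |μ y - b y| ≤ ∑ S, w S * √(min (∑ y ∈ S, b y) (1 - ∑ y ∈ S, b y)) := by
  have hw1 : ∑ S, w S * ∑ y ∈ S, b y = 1 := by
    rw [sum_weights_mul_mass]
    exact (Finset.sum_congr rfl fun y _ => (hrep y).symm).trans hμ1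
  have hm0 : ∀ S : Finset ι, 0 ≤ ∑ y ∈ S, b y := fun S => Finset.sum_nonneg fun y _ => hb y
  have hm1 : ∀ S : Finset ι, ∑ y ∈ S, b y ≤ 1 := fun S => by
    rw [← hb1]
    exact Finset.sum_le_univ_sum_of_nonneg hb
  have hpt : ∀ y, |μ y - b y| ≤
      ∑ S, w S * (b y * |(if y ∈ S then 1 else 0) - ∑ z ∈ S, b z|) := fun y => by
    have e : μ y - b y =
        ∑ S, w S * (b y * ((if y ∈ S then 1 else 0) - ∑ z ∈ S, b z)) := by
      calc μ y - b y = b y * (∑ S, w S * (if y ∈ S then 1 else 0)) -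
            b y * ∑ S, w S * ∑ z ∈ S, b z := by rw [hrep y, hw1, mul_one]
        _ = _ := by
          rw [Finset.mul_sum, Finset.mul_sum, ← Finset.sum_sub_distrib]
          exact Finset.sum_congr rfl fun S _ => by ring
    rw [e]
    refine (Finset.abs_sum_le_sum_abs _ _).trans (le_of_eq (Finset.sum_congr rfl fun S _ => ?_))
    rw [abs_mul, abs_mul, abs_of_nonneg (hw S), abs_of_nonneg (hb y)]
  refine (Finset.sum_le_sum fun y _ => hpt y).trans ?_
  rw [Finset.sum_comm]
  refine Finset.sum_le_sum fun S _ => ?_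
  rw [← Finset.mul_sum]
  refine mul_le_mul_of_nonneg_left ?_ (hw S)
  refine le_trans (le_of_eq ?_) (two_mul_mul_one_sub_le_sqrt_min (hm0 S) (hm1 S))
  have hc : ∑ y ∈ Sᶜ, b y = 1 - ∑ y ∈ S, b y := by
    rw [← hb1, ← Finset.sum_add_sum_compl S, add_sub_cancel_left]
  have e1 : ∑ y ∈ S, b y * |(if y ∈ S then 1 else 0) - ∑ z ∈ S, b z| =
      (∑ y ∈ S, b y) * (1 - ∑ y ∈ S, b y) := by
    rw [Finset.sum_mul]
    exact Finset.sum_congr rfl fun y hy => by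
      rw [if_pos hy, abs_of_nonneg (sub_nonneg.2 (hm1 S))]
  have e2 : ∑ y ∈ Sᶜ, b y * |(if y ∈ S then 1 else 0) - ∑ z ∈ S, b z| =
      (1 - ∑ y ∈ S, b y) * ∑ y ∈ S, b y := by
    rw [← hc, Finset.sum_mul]
    exact Finset.sum_congr rfl fun y hy => by
      rw [if_neg (Finset.mem_compl.1 hy), zero_sub, abs_neg, abs_of_nonneg (hm0 S)]
  rw [← Finset.sum_add_sum_compl S, e1, e2]
  ring

theorem sum_mprod_zero {n : ℕ} {P : ℤ → Matrix (Fin n) (Fin n) ℝ}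
    (hP : ∀ s x, ∑ y, P s x y = 1) (k : ℕ) (x : Fin n) : ∑ y, mprod n P 0 k x y = 1 := by
  induction k with
  | zero => simp [mprod_self, Matrix.one_apply]
  | succ k ih =>
    push_cast
    rw [mprod_succ n P (by positivity)]
    simp_rw [Matrix.mul_apply]
    rw [Finset.sum_comm]
    simp_rw [← Finset.mul_sum, hP, mul_one]
    exact ih

/-- Evolving-set upper bound on mixing (Theorem 3.2): if
`(π_t^min π_0^min)^{-1/2} ∏_{s=1}^t [1 − (1/2)((1/2)(g_s/(1−g_s/2))Φ_s^*)²] ≤ 2ε`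
then `d(0,t) ≤ ε`. -/
theorem evolving_set_mixing_bound (n : ℕ) (hn : 1 ≤ n)
    (P : ℤ → Matrix (Fin n) (Fin n) ℝ)
    (hP : ∀ s, (∀ x y, 0 ≤ P s x y) ∧ ∀ x, ∑ y, P s x y = 1)
    (hlazy : ∀ s x, (1 : ℝ) / 2 ≤ P s x x)
    (π : ℤ → Fin n → ℝ) (hπ : IsTarget n P π)
    (t : ℕ) (ht : 0 < t)
    (hπpos : ∀ s : ℤ, 0 ≤ s → s ≤ (t : ℤ) → ∀ z, 0 < π s z)
    (ε : ℝ) (hε : ε ∈ Set.Ioo (0:ℝ) 1)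
    (hcond : (1 / Real.sqrt ((⨅ z : Fin n, π t z) * (⨅ z : Fin n, π 0 z))) *
      ∏ s ∈ Finset.Icc 1 t, (1 - (1 / 2) *
        ((1 / 2) * (gq n π s / (1 - gq n π s / 2)) * bigPhiStar n P π s) ^ 2) ≤ 2 * ε) :
    dTV n P π 0 t ≤ ε := by
  have : Nonempty (Fin n) := ⟨⟨0, hn⟩⟩
  have hmin : ∀ s : ℤ, (∀ z, 0 < π s z) → 0 < ⨅ z, π s z := fun s h => by
    obtain ⟨z, hz⟩ := exists_eq_ciInf_of_finite (f := π s)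
    rw [← hz]
    exact h z
  have hmin_le : ∀ (s : ℤ) z, ⨅ z, π s z ≤ π s z := fun s z =>
    ciInf_le (Set.finite_range _).bddBelow z
  have h0 := hmin 0 (hπpos 0 le_rfl (by positivity))
  have ht0 := hmin t (hπpos t (by positivity) le_rfl)
  have ht1 : ⨅ z, π t z ≤ 1 := by
    refine (hmin_le t (Classical.arbitrary _)).trans ?_
    rw [← (hπ t).2.1]
    exact Finset.single_le_sum (fun y _ => (hπ t).1 y) (Finset.mem_univ _)
  have hprod : 0 ≤ ∏ s ∈ Finset.Icc 1 t, contraction n P π s := by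
    refine Finset.prod_nonneg fun s hs => ?_
    obtain ⟨k, rfl⟩ : ∃ k, s = k + 1 := ⟨s - 1, by have := (Finset.mem_Icc.1 hs).1; omega⟩
    have hk := (Finset.mem_Icc.1 hs).2
    push_cast
    exact contraction_nonneg hP hlazy hπ (hπpos k (by positivity) (by omega))
      (hπpos (k + 1) (by positivity) (by omega))
  refine ciSup_le fun x => ?_
  obtain ⟨w, hw, hrep, hle⟩ := exists_set_representation hP hlazy hπ x t hπpos
  have hL1 := sum_abs_sub_le_of_representation (mprod n P 0 t x) (π t) (hπ t).1 (hπ t).2.1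
    (sum_mprod_zero (fun s => (hP s).2) t x) w hw hrep
  have hsqrt : 1 / √(π 0 x) ≤ 1 / √((⨅ z, π t z) * ⨅ z, π 0 z) := by
    refine one_div_le_one_div_of_le (Real.sqrt_pos.2 (mul_pos ht0 h0)) (Real.sqrt_le_sqrt ?_)
    exact (mul_le_of_le_one_left h0.le ht1).trans (hmin_le 0 x)
  have hfac := mul_le_mul_of_nonneg_left hsqrt hprod
  have hcond' : 1 / √((⨅ z, π t z) * ⨅ z, π 0 z) *
      ∏ s ∈ Finset.Icc 1 t, contraction n P π s ≤ 2 * ε := hcond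
  linarith
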